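/- arXiv:1106.4063 — 7 statements merged into one kernel-verified Lean document; each statement's English description precedes it below -/
import Mathlib

section
/- For every positive semidefinite d×d complex matrix ρ, the series Σ_{n=0}^∞ E₀(Gⁿ(ρ)) converges in the space of d×d complex matrices, and its sum F(ρ) satisfies the recursive equation F(ρ) = E₀(ρ) + F(G(ρ)). -/
open Matrix Kronecker Filter Topology
open scoped ComplexOrder

/-- The entries of a positive semidefinite complex matrix are bounded by its trace. -/
lemma Matrix.PosSemidef.norm_apply_le_re_trace {n : Type*} [Fintype n]
    {A : Matrix n n ℂ} (hA : A.PosSemidef) (i j : n) : ‖A i j‖ ≤ A.trace.re := by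
  have diag_nonneg : ∀ k, 0 ≤ (A k k).re := fun k => (Complex.le_def.1 hA.diag_nonneg).1
  have diag_im : ∀ k, (A k k).im = 0 := fun k => (Complex.le_def.1 hA.diag_nonneg).2.symm
  have diag_le : ∀ k, (A k k).re ≤ A.trace.re := fun k => by
    rw [Matrix.trace, Complex.re_sum]
    exact Finset.single_le_sum (f := fun k => (A k k).re) (fun l _ => diag_nonneg l)
      (Finset.mem_univ k)
  have hdet := (Complex.le_def.1 (hA.submatrix ![i, j]).det_nonneg).1
  have hji : A j i = star (A i j) := (hA.isHermitian.apply j i).symm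
  have hminor : ‖A i j‖ ^ 2 ≤ (A i i).re * (A j j).re := by
    rw [Matrix.det_fin_two] at hdet
    simp [hji, diag_im] at hdet
    rw [← Complex.normSq_eq_norm_sq, Complex.normSq_apply]
    linarith
  refine abs_le_of_sq_le_sq' ?_ ((diag_nonneg i).trans (diag_le i)) |>.2
  calc ‖A i j‖ ^ 2 ≤ (A i i).re * (A j j).re := hminor
    _ ≤ A.trace.re * A.trace.re :=
      mul_le_mul (diag_le i) (diag_le j) (diag_nonneg j) ((diag_nonneg i).trans (diag_le i))
    _ = A.trace.re ^ 2 := (sq _).symm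

/-- A family of positive semidefinite matrices is summable as soon as its traces are. -/
lemma Matrix.summable_of_summable_re_trace {n κ : Type*} [Fintype n]
    {A : κ → Matrix n n ℂ} (hA : ∀ k, (A k).PosSemidef)
    (h : Summable fun k => (A k).trace.re) : Summable A :=
  Pi.summable.2 fun i => Pi.summable.2 fun j =>
    Summable.of_norm_bounded h fun k => (hA k).norm_apply_le_re_trace i j

section LoopStep

variable {n ι : Type*} [Fintype n] [Fintype ι]

/-- One round of the loop: continue with `M1`, then apply the channel with Kraus operators `E`. -/
def loopStep (E : ι → Matrix n n ℂ) (M1 ρ : Matrix n n ℂ) : Matrix n n ℂ :=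
  ∑ i, (E i * M1) * ρ * (E i * M1)ᴴ

lemma loopStep_iterate_posSemidef (E : ι → Matrix n n ℂ) (M1 : Matrix n n ℂ)
    {ρ : Matrix n n ℂ} (hρ : ρ.PosSemidef) (k : ℕ) : ((loopStep E M1)^[k] ρ).PosSemidef := by
  induction k with
  | zero => exact hρ
  | succ k ih =>
    rw [Function.iterate_succ_apply']
    exact Matrix.posSemidef_sum _ fun i _ => ih.mul_mul_conjTranspose_same _

lemma trace_exit_add_trace_loopStep [DecidableEq n] {E : ι → Matrix n n ℂ}
    (hE : ∑ i, (E i)ᴴ * E i = 1)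
    {M0 M1 : Matrix n n ℂ} (hM : M0ᴴ * M0 + M1ᴴ * M1 = 1) (ρ : Matrix n n ℂ) :
    (M0 * ρ * M0ᴴ).trace + (loopStep E M1 ρ).trace = ρ.trace := by
  have hstep : (loopStep E M1 ρ).trace = (M1ᴴ * M1 * ρ).trace := by
    calc (loopStep E M1 ρ).trace = ∑ i, (M1ᴴ * ((E i)ᴴ * E i) * M1 * ρ).trace := by
          rw [loopStep, Matrix.trace_sum]
          refine Finset.sum_congr rfl fun i _ => ?_
          rw [Matrix.trace_mul_comm, Matrix.conjTranspose_mul]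
          simp only [Matrix.mul_assoc]
      _ = (M1ᴴ * M1 * ρ).trace := by
          rw [← Matrix.trace_sum, ← Finset.sum_mul, ← Finset.sum_mul, ← Finset.mul_sum, hE,
            Matrix.mul_one]
  rw [hstep, Matrix.trace_mul_comm, ← Matrix.mul_assoc, ← Matrix.trace_add, ← Matrix.add_mul, hM,
    Matrix.one_mul]

lemma summable_exit_loopStep_iterate [DecidableEq n] {E : ι → Matrix n n ℂ}
    (hE : ∑ i, (E i)ᴴ * E i = 1)
    {M0 M1 : Matrix n n ℂ} (hM : M0ᴴ * M0 + M1ᴴ * M1 = 1) {ρ : Matrix n n ℂ}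
    (hρ : ρ.PosSemidef) : Summable fun k => M0 * (loopStep E M1)^[k] ρ * M0ᴴ := by
  have hpos := loopStep_iterate_posSemidef E M1 hρ
  have hexit : ∀ k, (M0 * (loopStep E M1)^[k] ρ * M0ᴴ).PosSemidef :=
    fun k => (hpos k).mul_mul_conjTranspose_same _
  refine Matrix.summable_of_summable_re_trace hexit ?_
  refine summable_of_sum_range_le (c := ρ.trace.re)
    (fun k => (Complex.le_def.1 (hexit k).trace_nonneg).1) fun N => ?_
  have hsum : ∑ k ∈ Finset.range N, (M0 * (loopStep E M1)^[k] ρ * M0ᴴ).trace.re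
      + ((loopStep E M1)^[N] ρ).trace.re = ρ.trace.re := by
    induction N with
    | zero => simp
    | succ N ih =>
      have h := congrArg Complex.re
        (trace_exit_add_trace_loopStep hE hM ((loopStep E M1)^[N] ρ))
      rw [Complex.add_re] at h
      rw [Finset.sum_range_succ, Function.iterate_succ_apply', add_assoc, h, ih]
  have hrest : 0 ≤ ((loopStep E M1)^[N] ρ).trace.re :=
    (Complex.le_def.1 (hpos N).trace_nonneg).1
  linarith

end LoopStep

theorem stmt2 (d : ℕ) (hd : 0 < d) (ι : Type) [Fintype ι]
    (E : ι → Matrix (Fin d) (Fin d) ℂ) (hE : ∑ i, (E i)ᴴ * E i = 1)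
    (M0 M1 : Matrix (Fin d) (Fin d) ℂ) (hM : M0ᴴ * M0 + M1ᴴ * M1 = 1) :
    ∃ F : Matrix (Fin d) (Fin d) ℂ → Matrix (Fin d) (Fin d) ℂ,
      ∀ ρ : Matrix (Fin d) (Fin d) ℂ, ρ.PosSemidef →
        Tendsto (fun N => ∑ n ∈ Finset.range N, M0 * ((fun ρ : Matrix (Fin d) (Fin d) ℂ => ∑ i, (E i * M1) * ρ * (E i * M1)ᴴ)^[n] ρ) * M0ᴴ) atTop (nhds (F ρ)) ∧
          F ρ = M0 * ρ * M0ᴴ + F ((fun ρ : Matrix (Fin d) (Fin d) ℂ => ∑ i, (E i * M1) * ρ * (E i * M1)ᴴ) ρ) := by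
  refine ⟨fun ρ => ∑' n, M0 * (loopStep E M1)^[n] ρ * M0ᴴ, fun ρ hρ => ?_⟩
  have hs := summable_exit_loopStep_iterate hE hM hρ
  exact ⟨hs.hasSum.tendsto_sum_nat, hs.tsum_eq_zero_add⟩
end

section
/- Let P and Q be d×d Hermitian matrices satisfying E*(M₀ᴴ P M₀ + M₁ᴴ Q M₁) = Q. Then for every density matrix ρ₀ and every integer n ≥ 0: tr((M₀ᴴ P M₀ + M₁ᴴ Q M₁) ρ₀) = Σ_{k=0}^{n} tr(P · E₀(Gᵏ(ρ₀))) + tr(Q · E₁(Gⁿ(ρ₀))). -/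
open Matrix Kronecker Filter Topology
open scoped ComplexOrder

/-- A map in Kraus form and its dual are adjoint for the trace pairing. -/
theorem trace_kraus_dual_mul {m n ι : Type*} [Fintype m] [Fintype n] [Fintype ι]
    (E : ι → Matrix m n ℂ) (R : Matrix m m ℂ) (ρ : Matrix n n ℂ) :
    ((∑ i, (E i)ᴴ * R * E i) * ρ).trace = (R * ∑ i, E i * ρ * (E i)ᴴ).trace := by
  simp only [Finset.sum_mul, Finset.mul_sum, Matrix.trace_sum]
  refine Finset.sum_congr rfl fun i _ => ?_
  rw [Matrix.mul_assoc, Matrix.mul_assoc, Matrix.trace_mul_comm]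
  simp only [Matrix.mul_assoc]

/-- Trace duality for conjugation by a single matrix. -/
theorem trace_conj_dual_mul {m n : Type*} [Fintype m] [Fintype n]
    (M : Matrix m n ℂ) (R : Matrix m m ℂ) (ρ : Matrix n n ℂ) :
    (Mᴴ * R * M * ρ).trace = (R * (M * ρ * Mᴴ)).trace := by
  simpa using trace_kraus_dual_mul (fun _ : Unit => M) R ρ

theorem stmt3 (d : ℕ) (hd : 0 < d) (ι : Type) [Fintype ι]
    (E : ι → Matrix (Fin d) (Fin d) ℂ) (hE : ∑ i, (E i)ᴴ * E i = 1)
    (M0 M1 : Matrix (Fin d) (Fin d) ℂ) (hM : M0ᴴ * M0 + M1ᴴ * M1 = 1)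
    (P Q : Matrix (Fin d) (Fin d) ℂ) (hP : P.IsHermitian) (hQ : Q.IsHermitian)
    (hfix : ∑ i, (E i)ᴴ * (M0ᴴ * P * M0 + M1ᴴ * Q * M1) * E i = Q)
    (ρ₀ : Matrix (Fin d) (Fin d) ℂ) (hρ₀ : ρ₀.PosSemidef) (htr : ρ₀.trace = 1)
    (n : ℕ) :
    ((M0ᴴ * P * M0 + M1ᴴ * Q * M1) * ρ₀).trace =
      (∑ k ∈ Finset.range (n + 1), (P * (M0 * ((fun ρ : Matrix (Fin d) (Fin d) ℂ => ∑ i, (E i * M1) * ρ * (E i * M1)ᴴ)^[k] ρ₀) * M0ᴴ)).trace) +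
        (Q * (M1 * ((fun ρ : Matrix (Fin d) (Fin d) ℂ => ∑ i, (E i * M1) * ρ * (E i * M1)ᴴ)^[n] ρ₀) * M1ᴴ)).trace := by
  induction n with
  | zero => simp [Matrix.add_mul, trace_conj_dual_mul]
  | succ n ih =>
    rw [ih, Finset.sum_range_succ _ (n + 1), add_assoc]
    congr 1
    rw [Function.iterate_succ_apply']
    generalize (fun ρ : Matrix (Fin d) (Fin d) ℂ =>
      ∑ i, (E i * M1) * ρ * (E i * M1)ᴴ)^[n] ρ₀ = ρ
    have hG : ∑ i, (E i * M1) * ρ * (E i * M1)ᴴ = ∑ i, E i * (M1 * ρ * M1ᴴ) * (E i)ᴴ := by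
      simp only [Matrix.conjTranspose_mul, Matrix.mul_assoc]
    rw [hG, ← trace_conj_dual_mul M0, ← trace_conj_dual_mul M1 Q (∑ i, _), ← Matrix.trace_add,
      ← Matrix.add_mul, ← trace_kraus_dual_mul, hfix]
end

section
/- (Correctness of the quantum Sharir–Pnueli–Hart method.) Let ρ₀ be a density matrix, and let P and Q be positive semidefinite d×d matrices such that E*(M₀ᴴ P M₀ + M₁ᴴ Q M₁) = Q and tr(Q · E₁(Gⁿ(ρ₀))) → 0 as n → ∞. Then the series Σ_{n=0}^∞ tr(P · E₀(Gⁿ(ρ₀))) of (nonnegative real) numbers converges, with sum equal to tr((M₀ᴴ P M₀ + M₁ᴴ Q M₁) ρ₀). -/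
open Matrix Kronecker Filter Topology
open scoped ComplexOrder

theorem trace_conj_mul {n : Type*} [Fintype n] (M P σ : Matrix n n ℂ) :
    (Mᴴ * P * M * σ).trace = (P * (M * σ * Mᴴ)).trace := by
  rw [Matrix.mul_assoc, Matrix.mul_assoc, trace_mul_comm, Matrix.mul_assoc]

/-- Duality between a super-operator in Kraus form and its adjoint under the trace pairing. -/
theorem trace_mul_sum_kraus {n ι : Type*} [Fintype n] [Fintype ι]
    (K : ι → Matrix n n ℂ) (A B R σ : Matrix n n ℂ) :
    (R * ∑ i, (K i * A) * σ * (K i * B)ᴴ).trace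
      = ((∑ i, (K i)ᴴ * R * K i) * (A * σ * Bᴴ)).trace := by
  simp only [Finset.mul_sum, Finset.sum_mul, trace_sum]
  refine Finset.sum_congr rfl fun i _ => ?_
  rw [trace_conj_mul]
  simp only [conjTranspose_mul, Matrix.mul_assoc]

theorem stmt4 (d : ℕ) (hd : 0 < d) (ι : Type) [Fintype ι]
    (E : ι → Matrix (Fin d) (Fin d) ℂ) (hE : ∑ i, (E i)ᴴ * E i = 1)
    (M0 M1 : Matrix (Fin d) (Fin d) ℂ) (hM : M0ᴴ * M0 + M1ᴴ * M1 = 1)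
    (ρ₀ : Matrix (Fin d) (Fin d) ℂ) (hρ₀ : ρ₀.PosSemidef) (htr : ρ₀.trace = 1)
    (P Q : Matrix (Fin d) (Fin d) ℂ) (hP : P.PosSemidef) (hQ : Q.PosSemidef)
    (hfix : ∑ i, (E i)ᴴ * (M0ᴴ * P * M0 + M1ᴴ * Q * M1) * E i = Q)
    (hterm : Tendsto (fun n => (Q * (M1 * ((fun ρ : Matrix (Fin d) (Fin d) ℂ => ∑ i, (E i * M1) * ρ * (E i * M1)ᴴ)^[n] ρ₀) * M1ᴴ)).trace) atTop (nhds 0)) :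
    Tendsto (fun N => ∑ n ∈ Finset.range N, (P * (M0 * ((fun ρ : Matrix (Fin d) (Fin d) ℂ => ∑ i, (E i * M1) * ρ * (E i * M1)ᴴ)^[n] ρ₀) * M0ᴴ)).trace) atTop
      (nhds (((M0ᴴ * P * M0 + M1ᴴ * Q * M1) * ρ₀).trace)) := by
  set G : Matrix (Fin d) (Fin d) ℂ → Matrix (Fin d) (Fin d) ℂ :=
    fun ρ => ∑ i, (E i * M1) * ρ * (E i * M1)ᴴ with hG
  set R := M0ᴴ * P * M0 + M1ᴴ * Q * M1 with hR
  have split_trace (σ : Matrix (Fin d) (Fin d) ℂ) :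
      (R * σ).trace = (P * (M0 * σ * M0ᴴ)).trace + (Q * (M1 * σ * M1ᴴ)).trace := by
    rw [hR, Matrix.add_mul, trace_add, trace_conj_mul, trace_conj_mul]
  have step (n : ℕ) : (R * G^[n + 1] ρ₀).trace = (Q * (M1 * G^[n] ρ₀ * M1ᴴ)).trace := by
    rw [Function.iterate_succ_apply', hG, trace_mul_sum_kraus, hfix]
  have partial_sum (N : ℕ) :
      ∑ n ∈ Finset.range N, (P * (M0 * G^[n] ρ₀ * M0ᴴ)).trace
        = (R * ρ₀).trace - (R * G^[N] ρ₀).trace := by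
    induction N with
    | zero => simp
    | succ N ih => rw [Finset.sum_range_succ, ih, step, split_trace (G^[N] ρ₀)]; ring
  have remainder : Tendsto (fun N => (R * G^[N] ρ₀).trace) atTop (𝓝 0) := by
    rw [← tendsto_add_atTop_iff_nat 1]
    simpa only [step] using hterm
  simpa only [partial_sum, sub_zero] using remainder.const_sub (R * ρ₀).trace
end

section
/- (Completeness of the quantum Sharir–Pnueli–Hart method.) For every positive semidefinite d×d matrix P there exists a positive semidefinite d×d matrix Q̄ such that: (i) E*(M₀ᴴ P M₀ + M₁ᴴ Q̄ M₁) = Q̄; (ii) Q̄ is least among all solutions, i.e. for every positive semidefinite Q with E*(M₀ᴴ P M₀ + M₁ᴴ Q M₁) = Q one has Q̄ ⊑ Q in the Löwner order (Q − Q̄ is positive semidefinite); and (iii) for every density matrix ρ₀, the series Σ_{n=0}^∞ tr(P · E₀(Gⁿ(ρ₀))) converges with sum tr((M₀ᴴ P M₀ + M₁ᴴ Q̄ M₁) ρ₀), and tr(Q̄ · E₁(Gⁿ(ρ₀))) → 0 as n → ∞. -/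
open Matrix Kronecker Filter Topology
open scoped ComplexOrder

namespace Matrix

section PosSemidef

variable {n : Type*} [Fintype n]

theorem isClosed_setOf_posSemidef : IsClosed {A : Matrix n n ℂ | A.PosSemidef} := by
  simp only [posSemidef_iff_dotProduct_mulVec, Set.ofPred_and, Set.ofPred_forall]
  refine IsClosed.inter (isClosed_eq (by fun_prop) continuous_id) (isClosed_iInter fun x => ?_)
  exact isClosed_le continuous_const (by fun_prop)

section

open scoped MatrixOrder Matrix.Norms.L2Operator

theorem PosSemidef.exists_smul_one_sub_posSemidef [DecidableEq n] {A : Matrix n n ℂ}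
    (hA : A.PosSemidef) : ∃ c : ℝ, 0 ≤ c ∧ ((c : ℂ) • (1 : Matrix n n ℂ) - A).PosSemidef := by
  refine ⟨‖A‖, norm_nonneg A, ?_⟩
  have h : A ≤ algebraMap ℝ (Matrix n n ℂ) ‖A‖ :=
    IsSelfAdjoint.le_algebraMap_norm_self (A := Matrix n n ℂ) hA.1
  rw [Matrix.le_iff, Algebra.algebraMap_eq_smul_one] at h
  simpa only [Complex.coe_smul] using h

theorem PosSemidef.exists_eq_conjTranspose_mul_self {A : Matrix n n ℂ} (hA : A.PosSemidef) :
    ∃ B : Matrix n n ℂ, A = Bᴴ * B := by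
  classical
  exact CStarAlgebra.nonneg_iff_eq_star_mul_self.mp hA.nonneg

end

section

open scoped Matrix.Norms.Frobenius

theorem trace_conjTranspose_mul_self_eq_frobenius_norm_sq (B : Matrix n n ℂ) :
    (Bᴴ * B).trace.re = ‖B‖ ^ 2 := by
  rw [frobenius_norm_def, ← Real.sqrt_eq_rpow, Real.sq_sqrt (by positivity), Finset.sum_comm]
  simp [trace, mul_apply, ← Complex.normSq_eq_conj_mul_self, Complex.normSq_eq_norm_sq,
    -Complex.ofReal_pow]

theorem PosSemidef.frobenius_norm_le_trace {A : Matrix n n ℂ} (hA : A.PosSemidef) :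
    ‖A‖ ≤ A.trace.re := by
  obtain ⟨B, rfl⟩ := hA.exists_eq_conjTranspose_mul_self
  rw [trace_conjTranspose_mul_self_eq_frobenius_norm_sq, sq]
  simpa only [frobenius_norm_conjTranspose] using frobenius_norm_mul Bᴴ B

theorem summable_of_posSemidef_of_sum_le {R : ℕ → Matrix n n ℂ} {C : Matrix n n ℂ}
    (hR : ∀ k, (R k).PosSemidef) (hC : ∀ N, (C - ∑ k ∈ Finset.range N, R k).PosSemidef) :
    Summable R := by
  refine .of_norm <|
    summable_of_sum_range_le (c := C.trace.re) (fun _ => norm_nonneg _) fun N => ?_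
  refine (Finset.sum_le_sum fun k _ => (hR k).frobenius_norm_le_trace).trans ?_
  have h := (Complex.nonneg_iff.mp (hC N).trace_nonneg).1
  rw [trace_sub, trace_sum, Complex.sub_re, Complex.re_sum] at h
  linarith

end

end PosSemidef

section Kraus

variable {ι n : Type*} [Fintype ι] [Fintype n]

/-- The super-operator `ρ ↦ ∑ i, K i * ρ * (K i)ᴴ` with Kraus operators `K`. -/
def krausMap (K : ι → Matrix n n ℂ) (ρ : Matrix n n ℂ) : Matrix n n ℂ :=
  ∑ i, K i * ρ * (K i)ᴴ

/-- The dual `Q ↦ ∑ i, (K i)ᴴ * Q * K i` of the super-operator with Kraus operators `K`. -/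
def krausDual (K : ι → Matrix n n ℂ) : Matrix n n ℂ →ₗ[ℂ] Matrix n n ℂ :=
  ∑ i, LinearMap.mulLeftRight ℂ ((K i)ᴴ, K i)

theorem krausDual_apply (K : ι → Matrix n n ℂ) (Q : Matrix n n ℂ) :
    krausDual K Q = ∑ i, (K i)ᴴ * Q * K i := by
  simp [krausDual]

theorem continuous_krausDual (K : ι → Matrix n n ℂ) : Continuous (krausDual K) := by
  simp only [funext (krausDual_apply K)]
  fun_prop

theorem PosSemidef.krausDual {Q : Matrix n n ℂ} (hQ : Q.PosSemidef) (K : ι → Matrix n n ℂ) :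
    (krausDual K Q).PosSemidef := by
  rw [krausDual_apply]
  exact posSemidef_sum _ fun i _ => hQ.conjTranspose_mul_mul_same (K i)

theorem krausDual_mul_right (K : ι → Matrix n n ℂ) (M Q : Matrix n n ℂ) :
    Matrix.krausDual (fun i => K i * M) Q = Mᴴ * Matrix.krausDual K Q * M := by
  simp only [krausDual_apply, Finset.mul_sum, Finset.sum_mul, conjTranspose_mul, Matrix.mul_assoc]

theorem trace_krausDual_mul (K : ι → Matrix n n ℂ) (Q ρ : Matrix n n ℂ) :
    (krausDual K Q * ρ).trace = (Q * krausMap K ρ).trace := by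
  simp only [krausDual_apply, krausMap, Finset.mul_sum, Finset.sum_mul, trace_sum]
  refine Finset.sum_congr rfl fun i _ => ?_
  rw [Matrix.mul_assoc, Matrix.mul_assoc, trace_mul_comm]
  simp only [Matrix.mul_assoc]

theorem trace_krausDual_iterate_mul (K : ι → Matrix n n ℂ) (Q ρ : Matrix n n ℂ) (k : ℕ) :
    ((krausDual K)^[k] Q * ρ).trace = (Q * (krausMap K)^[k] ρ).trace := by
  induction k generalizing Q with
  | zero => rfl
  | succ k ih =>
    rw [Function.iterate_succ_apply, ih, trace_krausDual_mul, Function.iterate_succ_apply']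

theorem PosSemidef.krausDual_iterate {A : Matrix n n ℂ} (hA : A.PosSemidef)
    (K : ι → Matrix n n ℂ) (k : ℕ) : ((Matrix.krausDual K)^[k] A).PosSemidef := by
  induction k with
  | zero => exact hA
  | succ k ih => rw [Function.iterate_succ_apply']; exact ih.krausDual K

theorem sum_range_succ_krausDual_iterate (K : ι → Matrix n n ℂ) (A : Matrix n n ℂ) (N : ℕ) :
    ∑ k ∈ Finset.range (N + 1), (krausDual K)^[k] A =
      A + krausDual K (∑ k ∈ Finset.range N, (krausDual K)^[k] A) := by
  simp only [Finset.sum_range_succ', map_sum, Function.iterate_succ_apply', Function.iterate_zero,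
    id, add_comm]

theorem PosSemidef.sub_sum_krausDual_iterate {K : ι → Matrix n n ℂ} {A T : Matrix n n ℂ}
    (hT : T.PosSemidef) (h : (T - (A + Matrix.krausDual K T)).PosSemidef) (N : ℕ) :
    (T - ∑ k ∈ Finset.range N, (Matrix.krausDual K)^[k] A).PosSemidef := by
  induction N with
  | zero => simpa using hT
  | succ N ih =>
    have := h.add (ih.krausDual K)
    rw [sum_range_succ_krausDual_iterate]
    rw [map_sub] at this
    convert this using 1
    abel

/-- If `A + K* C ⊑ C`, the Neumann series of `A` under the dual `K*` converges to a fixed point of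
`X ↦ A + K* X`, which lies below every `T` with `A + K* T ⊑ T`. -/
theorem exists_least_krausDual_fixedPoint {K : ι → Matrix n n ℂ} {A C : Matrix n n ℂ}
    (hA : A.PosSemidef) (hC : C.PosSemidef) (h : (C - (A + krausDual K C)).PosSemidef) :
    ∃ S : Matrix n n ℂ, S.PosSemidef ∧
      Tendsto (fun N => ∑ k ∈ Finset.range N, (krausDual K)^[k] A) atTop (𝓝 S) ∧
      A + krausDual K S = S ∧
      ∀ T : Matrix n n ℂ, T.PosSemidef → (T - (A + krausDual K T)).PosSemidef →
        (T - S).PosSemidef := by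
  have hsum : Summable fun k => (krausDual K)^[k] A :=
    summable_of_posSemidef_of_sum_le (hA.krausDual_iterate K) (hC.sub_sum_krausDual_iterate h)
  have hlim := hsum.hasSum.tendsto_sum_nat
  refine ⟨_, ?_, hlim, ?_, fun T hT hTA => ?_⟩
  · exact isClosed_setOf_posSemidef.mem_of_tendsto hlim (.of_forall fun N =>
      posSemidef_sum _ fun k _ => hA.krausDual_iterate K k)
  · refine tendsto_nhds_unique ?_ (hlim.comp (tendsto_add_atTop_nat 1))
    simp only [Function.comp_def, sum_range_succ_krausDual_iterate]
    exact (((continuous_krausDual K).tendsto _).comp hlim).const_add A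
  · exact isClosed_setOf_posSemidef.mem_of_tendsto (hlim.const_sub T)
      (.of_forall (hT.sub_sum_krausDual_iterate hTA))

theorem tendsto_sum_trace_krausMap_iterate {K : ι → Matrix n n ℂ} {A S : Matrix n n ℂ}
    (hS : Tendsto (fun N => ∑ k ∈ Finset.range N, (krausDual K)^[k] A) atTop (𝓝 S))
    (ρ : Matrix n n ℂ) :
    Tendsto (fun N => ∑ k ∈ Finset.range N, (A * (krausMap K)^[k] ρ).trace) atTop
      (𝓝 (S * ρ).trace) := by
  have hc : Continuous fun X : Matrix n n ℂ => (X * ρ).trace := by fun_prop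
  simpa only [Function.comp_def, Finset.sum_mul, trace_sum, trace_krausDual_iterate_mul] using
    (hc.tendsto S).comp hS

theorem tendsto_trace_krausMap_iterate_zero {K : ι → Matrix n n ℂ} {A S : Matrix n n ℂ}
    (hS : Tendsto (fun N => ∑ k ∈ Finset.range N, (krausDual K)^[k] A) atTop (𝓝 S))
    (hfix : A + krausDual K S = S) (ρ : Matrix n n ℂ) :
    Tendsto (fun k => (S * (krausMap K)^[k] ρ).trace) atTop (𝓝 0) := by
  have hstep (N : ℕ) : (S * (krausMap K)^[N] ρ).trace =
      (S * ρ).trace - ∑ k ∈ Finset.range N, (A * (krausMap K)^[k] ρ).trace := by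
    induction N with
    | zero => simp
    | succ N ih =>
      rw [Function.iterate_succ_apply', ← trace_krausDual_mul, eq_sub_of_add_eq' hfix, sub_mul,
        trace_sub, ih, Finset.sum_range_succ]
      ring
  simp only [hstep]
  simpa using (tendsto_sum_trace_krausMap_iterate hS ρ).const_sub (S * ρ).trace

end Kraus

end Matrix

theorem stmt5 (d : ℕ) (hd : 0 < d) (ι : Type) [Fintype ι]
    (E : ι → Matrix (Fin d) (Fin d) ℂ) (hE : ∑ i, (E i)ᴴ * E i = 1)
    (M0 M1 : Matrix (Fin d) (Fin d) ℂ) (hM : M0ᴴ * M0 + M1ᴴ * M1 = 1)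
    (P : Matrix (Fin d) (Fin d) ℂ) (hP : P.PosSemidef) :
    ∃ Qbar : Matrix (Fin d) (Fin d) ℂ, Qbar.PosSemidef ∧
      (∑ i, (E i)ᴴ * (M0ᴴ * P * M0 + M1ᴴ * Qbar * M1) * E i = Qbar) ∧
      (∀ Q : Matrix (Fin d) (Fin d) ℂ, Q.PosSemidef →
        (∑ i, (E i)ᴴ * (M0ᴴ * P * M0 + M1ᴴ * Q * M1) * E i = Q) → (Q - Qbar).PosSemidef) ∧
      (∀ ρ₀ : Matrix (Fin d) (Fin d) ℂ, ρ₀.PosSemidef → ρ₀.trace = 1 →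
        Tendsto (fun N => ∑ n ∈ Finset.range N, (P * (M0 * ((fun ρ : Matrix (Fin d) (Fin d) ℂ => ∑ i, (E i * M1) * ρ * (E i * M1)ᴴ)^[n] ρ₀) * M0ᴴ)).trace) atTop
            (nhds (((M0ᴴ * P * M0 + M1ᴴ * Qbar * M1) * ρ₀).trace)) ∧
          Tendsto (fun n => (Qbar * (M1 * ((fun ρ : Matrix (Fin d) (Fin d) ℂ => ∑ i, (E i * M1) * ρ * (E i * M1)ᴴ)^[n] ρ₀) * M1ᴴ)).trace) atTop (nhds 0)) := by
  have hG : (fun ρ : Matrix (Fin d) (Fin d) ℂ => ∑ i, (E i * M1) * ρ * (E i * M1)ᴴ) =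
      krausMap fun i => E i * M1 := rfl
  simp only [hG, ← krausDual_apply E]
  obtain ⟨c, hc, hcP⟩ := hP.exists_smul_one_sub_posSemidef
  have hE1 : krausDual E 1 = 1 := by simpa [krausDual_apply] using hE
  have hbound : ((c : ℂ) • (1 : Matrix (Fin d) (Fin d) ℂ) - (M0ᴴ * P * M0 +
      krausDual (fun i => E i * M1) ((c : ℂ) • 1))).PosSemidef := by
    convert hcP.conjTranspose_mul_mul_same M0 using 1
    rw [krausDual_mul_right, map_smul, hE1]
    simp only [mul_sub, sub_mul, mul_smul_comm, smul_mul_assoc, mul_one]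
    rw [eq_sub_of_add_eq hM, smul_sub]
    abel
  have hcone : ((c : ℂ) • (1 : Matrix (Fin d) (Fin d) ℂ)).PosSemidef :=
    PosSemidef.one.smul (Complex.zero_le_real.mpr hc)
  obtain ⟨S, hSpos, hSlim, hSfix, hSleast⟩ :=
    exists_least_krausDual_fixedPoint (hP.conjTranspose_mul_mul_same M0) hcone hbound
  have hfix : M0ᴴ * P * M0 + M1ᴴ * krausDual E S * M1 = S := by
    rwa [krausDual_mul_right] at hSfix
  refine ⟨krausDual E S, hSpos.krausDual E, by rw [hfix], fun Q hQ hQfix => ?_,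
    fun ρ₀ _ _ => ⟨?_, ?_⟩⟩
  · have hT := hSleast (M0ᴴ * P * M0 + M1ᴴ * Q * M1)
      ((hP.conjTranspose_mul_mul_same M0).add (hQ.conjTranspose_mul_mul_same M1))
      (by simpa [krausDual_mul_right, hQfix] using PosSemidef.zero)
    simpa only [map_sub, hQfix] using hT.krausDual E
  · rw [hfix]
    convert tendsto_sum_trace_krausMap_iterate hSlim ρ₀ using 3 with N k
    rw [← Matrix.mul_assoc, ← Matrix.mul_assoc, trace_mul_comm]
    simp only [Matrix.mul_assoc]
  · convert (tendsto_trace_krausMap_iterate_zero hSlim hSfix ρ₀).comp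
      (tendsto_add_atTop_nat 1) using 2 with k
    rw [Function.comp_apply, Function.iterate_succ_apply', ← trace_krausDual_mul,
      krausDual_mul_right, ← Matrix.mul_assoc, ← Matrix.mul_assoc, trace_mul_comm]
    simp only [Matrix.mul_assoc]
end

section
/- Let P be a d×d Hermitian matrix and define the sequence of matrices Q₀ = 0 and Q_{n+1} = M₀ᴴ P M₀ + M₁ᴴ E*(Q_n) M₁ for n ≥ 0. Then for every d×d complex matrix ρ and every n ≥ 0: tr(P · E₀(ρ)) + tr(Q_n · G(ρ)) = Σ_{k=0}^{n} tr(P · E₀(Gᵏ(ρ))). -/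
open Matrix Kronecker Filter Topology
open scoped ComplexOrder

/-- Duality between the Kraus map with operators `A i = E i * B` and its Heisenberg-picture adjoint,
under the trace pairing. -/
theorem trace_conjTranspose_mul_sum_mul_mul {m ι : Type*} [Fintype m] [Fintype ι]
    (E : ι → Matrix m m ℂ) (B Q ρ : Matrix m m ℂ) :
    (Bᴴ * (∑ i, (E i)ᴴ * Q * E i) * B * ρ).trace =
      (Q * ∑ i, (E i * B) * ρ * (E i * B)ᴴ).trace := by
  simp only [Finset.mul_sum, Finset.sum_mul, trace_sum]
  refine Finset.sum_congr rfl fun i _ => ?_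
  calc (Bᴴ * ((E i)ᴴ * Q * E i) * B * ρ).trace
      = ((E i * B)ᴴ * (Q * (E i * B * ρ))).trace := by
        simp only [conjTranspose_mul, Matrix.mul_assoc]
    _ = (Q * (E i * B * ρ * (E i * B)ᴴ)).trace := by
        rw [trace_mul_comm, Matrix.mul_assoc Q]

theorem stmt6 (d : ℕ) (hd : 0 < d) (ι : Type) [Fintype ι]
    (E : ι → Matrix (Fin d) (Fin d) ℂ) (hE : ∑ i, (E i)ᴴ * E i = 1)
    (M0 M1 : Matrix (Fin d) (Fin d) ℂ) (hM : M0ᴴ * M0 + M1ᴴ * M1 = 1)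
    (P : Matrix (Fin d) (Fin d) ℂ) (hP : P.IsHermitian)
    (Q : ℕ → Matrix (Fin d) (Fin d) ℂ) (hQ0 : Q 0 = 0)
    (hQs : ∀ n, Q (n + 1) = M0ᴴ * P * M0 + M1ᴴ * (∑ i, (E i)ᴴ * Q n * E i) * M1)
    (ρ : Matrix (Fin d) (Fin d) ℂ) (n : ℕ) :
    (P * (M0 * ρ * M0ᴴ)).trace + (Q n * ((fun ρ : Matrix (Fin d) (Fin d) ℂ => ∑ i, (E i * M1) * ρ * (E i * M1)ᴴ) ρ)).trace =
      ∑ k ∈ Finset.range (n + 1), (P * (M0 * ((fun ρ : Matrix (Fin d) (Fin d) ℂ => ∑ i, (E i * M1) * ρ * (E i * M1)ᴴ)^[k] ρ) * M0ᴴ)).trace := by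
  induction n generalizing ρ with
  | zero => simp [hQ0]
  | succ n ih =>
    have hP0 : ∀ σ : Matrix (Fin d) (Fin d) ℂ,
        (M0ᴴ * P * M0 * σ).trace = (P * (M0 * σ * M0ᴴ)).trace := fun σ => by
      rw [Matrix.mul_assoc, Matrix.mul_assoc, trace_mul_comm]
      simp only [Matrix.mul_assoc]
    rw [Finset.sum_range_succ', hQs, Matrix.add_mul, trace_add, hP0,
      trace_conjTranspose_mul_sum_mul_mul, add_comm]
    simp only [Function.iterate_succ_apply, Function.iterate_zero, id_eq]
    rw [← ih]
end

section
/- For every integer n ≥ 0 and every vector α ∈ ℂ^(d·d), ‖Mⁿ · α‖ ≤ 4·√d·‖α‖, where ‖·‖ is the Euclidean norm on ℂ^(d·d) and Mⁿ · α denotes matrix–vector multiplication. -/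
open Matrix Kronecker Filter Topology
open scoped ComplexOrder

/-- The vector `v`, read as a matrix, has operator norm at most `c`; the bound on its sesquilinear
form is stated additively so that it is preserved by sums of Kraus operators. -/
def FormBound {m : Type*} [Fintype m] (c : ℝ) (v : m × m → ℂ) : Prop :=
  ∀ x y : m → ℂ, ‖v ⬝ᵥ fun p => star (x p.1) * y p.2‖ ≤
    c / 2 * (∑ i, ‖x i‖ ^ 2 + ∑ i, ‖y i‖ ^ 2)

section FormBound

variable {m : Type*} [Fintype m]

lemma kronecker_mulVec_prod (A B : Matrix m m ℂ) (a b : m → ℂ) :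
    (A ⊗ₖ B) *ᵥ (fun p => a p.1 * b p.2) = fun p => (A *ᵥ a) p.1 * (B *ᵥ b) p.2 := by
  ext p
  simp only [mulVec, dotProduct, kroneckerMap_apply, Fintype.sum_prod_type, Finset.sum_mul_sum]
  exact Finset.sum_congr rfl fun i _ => Finset.sum_congr rfl fun j _ => by ring

lemma star_dotProduct_self_eq_sum_norm_sq {k : Type*} [Fintype k] (x : k → ℂ) :
    star x ⬝ᵥ x = ((∑ i, ‖x i‖ ^ 2 : ℝ) : ℂ) := by
  simp [dotProduct, Complex.conj_mul']

lemma sum_norm_sq_mulVec {k l : Type*} [Fintype k] [Fintype l] (A : Matrix k l ℂ) (x : l → ℂ) :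
    ((∑ i, ‖(A *ᵥ x) i‖ ^ 2 : ℝ) : ℂ) = star x ⬝ᵥ ((Aᴴ * A) *ᵥ x) := by
  rw [← star_dotProduct_self_eq_sum_norm_sq, star_mulVec, ← dotProduct_mulVec, mulVec_mulVec]

/-- The operators `E i * M1` of one loop iteration do not increase the total squared norm. -/
lemma sum_norm_sq_kraus_mulVec_le [DecidableEq m] {ι : Type*} [Fintype ι]
    {E : ι → Matrix m m ℂ} (hE : ∑ i, (E i)ᴴ * E i = 1)
    {M0 M1 : Matrix m m ℂ} (hM : M0ᴴ * M0 + M1ᴴ * M1 = 1) (x : m → ℂ) :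
    ∑ k, ∑ i, ‖((E k * M1) *ᵥ x) i‖ ^ 2 ≤ ∑ i, ‖x i‖ ^ 2 := by
  have h₁ : ∑ k, ∑ i, ‖((E k * M1) *ᵥ x) i‖ ^ 2 = ∑ i, ‖(M1 *ᵥ x) i‖ ^ 2 := by
    apply Complex.ofReal_injective
    rw [Complex.ofReal_sum]
    simp_rw [← mulVec_mulVec, sum_norm_sq_mulVec (E _)]
    rw [← dotProduct_sum, ← sum_mulVec, hE, one_mulVec, star_dotProduct_self_eq_sum_norm_sq]
  have h₂ : ∑ i, ‖(M0 *ᵥ x) i‖ ^ 2 + ∑ i, ‖(M1 *ᵥ x) i‖ ^ 2 = ∑ i, ‖x i‖ ^ 2 := by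
    apply Complex.ofReal_injective
    rw [Complex.ofReal_add, sum_norm_sq_mulVec, sum_norm_sq_mulVec, ← dotProduct_add,
      ← add_mulVec, hM, one_mulVec, star_dotProduct_self_eq_sum_norm_sq]
  rw [h₁, ← h₂]
  exact le_add_of_nonneg_left (by positivity)

lemma FormBound.conjTranspose_mulVec {ι : Type*} [Fintype ι] {K : ι → Matrix m m ℂ}
    (hK : ∀ x : m → ℂ, ∑ k, ∑ i, ‖(K k *ᵥ x) i‖ ^ 2 ≤ ∑ i, ‖x i‖ ^ 2)
    {c : ℝ} (hc : 0 ≤ c) {v : m × m → ℂ} (hv : FormBound c v) :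
    FormBound c ((∑ k, K k ⊗ₖ (K k).map (starRingEnd ℂ))ᴴ *ᵥ v) := by
  intro x y
  have key : ((∑ k, K k ⊗ₖ (K k).map (starRingEnd ℂ))ᴴ *ᵥ v) ⬝ᵥ
      (fun p => star (x p.1) * y p.2) =
      ∑ k, v ⬝ᵥ fun p => star ((K k *ᵥ x) p.1) * (K k *ᵥ y) p.2 := by
    have hT : (∑ k, K k ⊗ₖ (K k).map (starRingEnd ℂ))ᴴᵀ =
        ∑ k, (K k).map (starRingEnd ℂ) ⊗ₖ K k := by
      ext p q
      simp [Matrix.sum_apply]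
    rw [dotProduct_comm, dotProduct_mulVec, ← mulVec_transpose, hT, dotProduct_comm, sum_mulVec,
      dotProduct_sum]
    refine Finset.sum_congr rfl fun k _ => ?_
    rw [kronecker_mulVec_prod _ _ (fun i => star (x i)) y]
    congr 1
    ext p
    simp [mulVec, dotProduct]
  rw [key]
  calc _ ≤ ∑ k, ‖v ⬝ᵥ fun p => star ((K k *ᵥ x) p.1) * (K k *ᵥ y) p.2‖ := norm_sum_le _ _
    _ ≤ ∑ k, c / 2 * (∑ i, ‖(K k *ᵥ x) i‖ ^ 2 + ∑ i, ‖(K k *ᵥ y) i‖ ^ 2) :=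
        Finset.sum_le_sum fun k _ => hv _ _
    _ = c / 2 * (∑ k, ∑ i, ‖(K k *ᵥ x) i‖ ^ 2 + ∑ k, ∑ i, ‖(K k *ᵥ y) i‖ ^ 2) := by
        rw [← Finset.mul_sum, Finset.sum_add_distrib]
    _ ≤ _ := by gcongr <;> exact hK _

lemma formBound_norm (v : EuclideanSpace ℂ (m × m)) : FormBound ‖v‖ v.ofLp := by
  intro x y
  have hxy : ∑ p : m × m, ‖star (x p.1) * y p.2‖ ^ 2 =
      (∑ i, ‖x i‖ ^ 2) * ∑ i, ‖y i‖ ^ 2 := by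
    simp [Fintype.sum_prod_type, Finset.sum_mul_sum, mul_pow]
  calc _ ≤ ∑ p, ‖v.ofLp p‖ * ‖star (x p.1) * y p.2‖ := by
        simpa only [dotProduct, norm_mul] using
          norm_sum_le Finset.univ fun p => v.ofLp p * (star (x p.1) * y p.2)
    _ ≤ √(∑ p, ‖v.ofLp p‖ ^ 2) * √(∑ p : m × m, ‖star (x p.1) * y p.2‖ ^ 2) :=
        Real.sum_mul_le_sqrt_mul_sqrt _ _ _
    _ = ‖v‖ * √((∑ i, ‖x i‖ ^ 2) * ∑ i, ‖y i‖ ^ 2) := by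
        rw [hxy, EuclideanSpace.norm_eq]
    _ ≤ ‖v‖ * ((∑ i, ‖x i‖ ^ 2 + ∑ i, ‖y i‖ ^ 2) / 2) := by
        gcongr
        apply Real.sqrt_le_iff.2 ⟨by positivity, ?_⟩
        nlinarith [sq_nonneg (∑ i, ‖x i‖ ^ 2 - ∑ i, ‖y i‖ ^ 2)]
    _ = _ := by ring

lemma FormBound.sum_norm_sq_column_le [DecidableEq m] {c : ℝ} (hc : 0 ≤ c) {v : m × m → ℂ}
    (hv : FormBound c v) (j : m) : ∑ i, ‖v (i, j)‖ ^ 2 ≤ c ^ 2 := by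
  set q := ∑ i, ‖v (i, j)‖ ^ 2 with hq
  have hq0 : 0 ≤ q := by positivity
  have scaled (t : ℝ) (ht : 0 ≤ t) : t * q ≤ c / 2 * (t ^ 2 * q + 1) := by
    have h := hv (fun i => t * v (i, j)) (Pi.single j 1)
    have e₁ : (v ⬝ᵥ fun p => star ((t : ℂ) * v (p.1, j)) * (Pi.single j 1 : m → ℂ) p.2) =
        ((t * q : ℝ) : ℂ) := by
      simp only [dotProduct, Fintype.sum_prod_type, Pi.single_apply, mul_ite, mul_one, mul_zero,
        Finset.sum_ite_eq', Finset.mem_univ, if_true, hq]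
      push_cast
      rw [Finset.mul_sum]
      refine Finset.sum_congr rfl fun i _ => ?_
      rw [← Complex.mul_conj']
      simp
      ring
    have e₂ : ∑ i, ‖(Pi.single j 1 : m → ℂ) i‖ ^ 2 = 1 := by
      rw [Finset.sum_eq_single j] <;> simp +contextual
    rw [e₁, e₂, Complex.norm_real, Real.norm_of_nonneg (by positivity)] at h
    simpa [mul_pow, ← Finset.mul_sum, ← hq] using h
  rcases hc.eq_or_lt with rfl | hc
  · nlinarith [scaled 1 zero_le_one]
  · have h := scaled c⁻¹ (by positivity)
    field_simp at h
    nlinarith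

lemma FormBound.norm_le [DecidableEq m] {c : ℝ} (hc : 0 ≤ c) {v : m × m → ℂ}
    (hv : FormBound c v) : ‖WithLp.toLp 2 v‖ ≤ √(Fintype.card m) * c := by
  rw [EuclideanSpace.norm_eq]
  apply Real.sqrt_le_iff.2 ⟨by positivity, ?_⟩
  rw [mul_pow, Real.sq_sqrt (by positivity), Fintype.sum_prod_type_right]
  simpa using Finset.sum_le_sum fun j (_ : j ∈ Finset.univ) => hv.sum_norm_sq_column_le hc j

open scoped Matrix.Norms.L2Operator in
lemma l2_opNorm_pow_kraus_le [DecidableEq m] {ι : Type*} [Fintype ι] {K : ι → Matrix m m ℂ}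
    (hK : ∀ x : m → ℂ, ∑ k, ∑ i, ‖(K k *ᵥ x) i‖ ^ 2 ≤ ∑ i, ‖x i‖ ^ 2) (n : ℕ) :
    ‖(∑ k, K k ⊗ₖ (K k).map (starRingEnd ℂ)) ^ n‖ ≤ √(Fintype.card m) := by
  rw [← l2_opNorm_conjTranspose, conjTranspose_pow, l2_opNorm_def]
  refine ContinuousLinearMap.opNorm_le_bound _ (by positivity) fun v => ?_
  have h : FormBound ‖v‖ (((∑ k, K k ⊗ₖ (K k).map (starRingEnd ℂ))ᴴ ^ n) *ᵥ v.ofLp) := by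
    induction n with
    | zero => simpa using formBound_norm v
    | succ n ih =>
      rw [pow_succ', ← mulVec_mulVec]
      exact ih.conjTranspose_mulVec hK (norm_nonneg v)
  exact h.norm_le (norm_nonneg v)

end FormBound

open scoped Matrix.Norms.L2Operator in
theorem stmt8 (d : ℕ) (hd : 0 < d) (ι : Type) [Fintype ι]
    (E : ι → Matrix (Fin d) (Fin d) ℂ) (hE : ∑ i, (E i)ᴴ * E i = 1)
    (M0 M1 : Matrix (Fin d) (Fin d) ℂ) (hM : M0ᴴ * M0 + M1ᴴ * M1 = 1)
    (n : ℕ) (α : EuclideanSpace ℂ (Fin d × Fin d)) :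
    ‖(EuclideanSpace.equiv (Fin d × Fin d) ℂ).symm
        (((∑ i, (E i * M1) ⊗ₖ (E i * M1).map (starRingEnd ℂ)) ^ n) *ᵥ (EuclideanSpace.equiv (Fin d × Fin d) ℂ) α)‖ ≤
      4 * Real.sqrt d * ‖α‖ := by
  have h := l2_opNorm_pow_kraus_le (sum_norm_sq_kraus_mulVec_le hE hM) n
  rw [Fintype.card_fin] at h
  refine (l2_opNorm_mulVec _ α).trans ?_
  gcongr
  linarith [Real.sqrt_nonneg (d : ℝ)]
end

section
/- For every density matrix ρ₀, the program with initial state ρ₀ terminates (i.e. tr(E₁(Gⁿ⁻¹(ρ₀))) = 0 for some integer n ≥ 1) if and only if Mⁿ · ((ρ₀ ⊗ I) · Φ) = 0 for some integer n ≥ 0. -/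
open Matrix Kronecker Filter Topology
open scoped ComplexOrder

/-- The row-major vectorization of a matrix intertwines `X ↦ A * X * Bᴴ` with `A ⊗ₖ B*`. -/
theorem kronecker_map_conj_mulVec {m n : Type*} [Fintype m] [Fintype n]
    (A : Matrix m m ℂ) (B : Matrix n n ℂ) (X : Matrix m n ℂ) :
    (A ⊗ₖ B.map (starRingEnd ℂ)) *ᵥ (fun p : m × n => X p.1 p.2) =
      fun p => (A * X * Bᴴ) p.1 p.2 := by
  ext ⟨j, k⟩
  simp only [mulVec, dotProduct, Fintype.sum_prod_type, kroneckerMap_apply, mul_apply, map_apply,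
    conjTranspose_apply, Finset.sum_mul, starRingEnd_apply]
  rw [Finset.sum_comm]
  refine Finset.sum_congr rfl fun a _ => Finset.sum_congr rfl fun b _ => ?_
  ring

theorem kronecker_one_mulVec_maxEntangled {m : Type*} [Fintype m] [DecidableEq m]
    (X : Matrix m m ℂ) :
    (X ⊗ₖ (1 : Matrix m m ℂ)) *ᵥ (fun p : m × m => if p.1 = p.2 then (1 : ℂ) else 0) =
      fun p => X p.1 p.2 := by
  ext ⟨j, k⟩
  simp [mulVec, dotProduct, Fintype.sum_prod_type, kroneckerMap_apply, one_apply]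

/-- Powers of the matrix representation of a super-operator represent its iterates. -/
theorem sum_kronecker_pow_mulVec {ι m : Type*} [Fintype ι] [Fintype m] [DecidableEq m]
    (A : ι → Matrix m m ℂ) (X : Matrix m m ℂ) (n : ℕ) :
    ((∑ i, A i ⊗ₖ (A i).map (starRingEnd ℂ)) ^ n) *ᵥ (fun p : m × m => X p.1 p.2) =
      fun p => ((fun ρ : Matrix m m ℂ => ∑ i, A i * ρ * (A i)ᴴ)^[n] X) p.1 p.2 := by
  induction n with
  | zero => simp
  | succ n ih =>
    rw [pow_succ', ← mulVec_mulVec, ih, sum_mulVec, Function.iterate_succ_apply']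
    simp only [kronecker_map_conj_mulVec]
    ext p
    simp [Matrix.sum_apply]

theorem posSemidef_iterate_sum_conj {ι m : Type*} [Fintype ι] [Fintype m]
    (A : ι → Matrix m m ℂ) {X : Matrix m m ℂ} (hX : X.PosSemidef) (n : ℕ) :
    ((fun ρ : Matrix m m ℂ => ∑ i, A i * ρ * (A i)ᴴ)^[n] X).PosSemidef := by
  induction n with
  | zero => exact hX
  | succ n ih =>
    rw [Function.iterate_succ_apply']
    exact posSemidef_sum _ fun i _ => ih.mul_mul_conjTranspose_same (A i)

theorem stmt14 (d : ℕ) (hd : 0 < d) (ι : Type) [Fintype ι]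
    (E : ι → Matrix (Fin d) (Fin d) ℂ) (hE : ∑ i, (E i)ᴴ * E i = 1)
    (M0 M1 : Matrix (Fin d) (Fin d) ℂ) (hM : M0ᴴ * M0 + M1ᴴ * M1 = 1)
    (ρ₀ : Matrix (Fin d) (Fin d) ℂ) (hρ₀ : ρ₀.PosSemidef) (htr : ρ₀.trace = 1) :
    (∃ n : ℕ, 1 ≤ n ∧ (M1 * ((fun ρ : Matrix (Fin d) (Fin d) ℂ => ∑ i, (E i * M1) * ρ * (E i * M1)ᴴ)^[n - 1] ρ₀) * M1ᴴ).trace = 0) ↔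
      (∃ n : ℕ, ((∑ i, (E i * M1) ⊗ₖ (E i * M1).map (starRingEnd ℂ)) ^ n) *ᵥ ((ρ₀ ⊗ₖ (1 : Matrix (Fin d) (Fin d) ℂ)) *ᵥ (fun p : Fin d × Fin d => if p.1 = p.2 then (1 : ℂ) else 0)) = 0) := by
  simp only [kronecker_one_mulVec_maxEntangled, sum_kronecker_pow_mulVec]
  constructor
  · rintro ⟨n, hn, h⟩
    obtain ⟨n, rfl⟩ := Nat.exists_eq_add_of_le' hn
    have h0 := (((posSemidef_iterate_sum_conj (fun i => E i * M1) hρ₀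
      n).mul_mul_conjTranspose_same M1).trace_eq_zero_iff).1 h
    refine ⟨n + 1, ?_⟩
    rw [Function.iterate_succ_apply']
    have h1 : ∀ Y : Matrix (Fin d) (Fin d) ℂ, M1 * Y * M1ᴴ = 0 →
        ∑ i, (E i * M1) * Y * (E i * M1)ᴴ = 0 := fun Y hY =>
      Finset.sum_eq_zero fun i _ => by
        rw [conjTranspose_mul, show E i * M1 * Y * (M1ᴴ * (E i)ᴴ) =
          E i * (M1 * Y * M1ᴴ) * (E i)ᴴ by simp only [Matrix.mul_assoc], hY]
        simp
    rw [h1 _ h0]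
    rfl
  · rintro ⟨n, h⟩
    refine ⟨n + 1, Nat.le_add_left 1 n, ?_⟩
    have h0 : (fun ρ : Matrix (Fin d) (Fin d) ℂ =>
        ∑ i, (E i * M1) * ρ * (E i * M1)ᴴ)^[n] ρ₀ = 0 := by
      ext j k
      exact congrFun h (j, k)
    rw [Nat.add_sub_cancel, h0]
    simp
end
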